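/- Let Σ be a finite alphabet and φ : Σ* → Σ* a nonerasing morphism. If b ∈ Σ is a periodic letter of finite order k > 1 and b occurs in φ^n(b) for some n ≥ 1, then φ^n(b) contains at least one letter of order k − 1. -/

import Mathlib

open Asymptotics Filter

/-- Apply a morphism (given by its values on letters) to a finite word. -/
def substWord {A : Type*} (φ : A → List A) : List A → List A
  | [] => []
  | a :: w => φ a ++ substWord φ w

/-- The `n`-th iterate of a morphism applied to a word. -/
def iterWord {A : Type*} (φ : A → List A) (n : ℕ) (w : List A) : List A :=
  (substWord φ)^[n] w

/-- The letter `b` has finite order `k`: `k ≥ 1` and `|φ^n(b)| = Θ(n^(k−1))`. -/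
def HasOrder {A : Type*} (φ : A → List A) (b : A) (k : ℕ) : Prop :=
  1 ≤ k ∧
    (fun n => ((iterWord φ n [b]).length : ℝ)) =Θ[atTop] (fun n => (n : ℝ) ^ (k - 1))

section IterWord

variable {A : Type*} {φ : A → List A}

theorem substWord_append (u v : List A) :
    substWord φ (u ++ v) = substWord φ u ++ substWord φ v := by
  induction u with
  | nil => rfl
  | cons a u ih => simp [substWord, ih]

theorem iterWord_append (m : ℕ) (u v : List A) :
    iterWord φ m (u ++ v) = iterWord φ m u ++ iterWord φ m v := by
  induction m generalizing u v with
  | zero => rfl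
  | succ m ih =>
    simp only [iterWord, Function.iterate_succ_apply, substWord_append] at ih ⊢
    exact ih _ _

theorem iterWord_add (m q : ℕ) (w : List A) :
    iterWord φ (m + q) w = iterWord φ m (iterWord φ q w) :=
  Function.iterate_add_apply _ _ _ _

theorem iterWord_nil (m : ℕ) : iterWord φ m [] = [] := by
  induction m with
  | zero => rfl
  | succ m ih => rw [iterWord_add]; exact ih

theorem iterWord_one (a : A) : iterWord φ 1 [a] = φ a := by
  simp [iterWord, substWord]

theorem iterWord_subset {m : ℕ} {c : A} {w : List A} (hc : c ∈ w) :
    iterWord φ m [c] ⊆ iterWord φ m w := by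
  obtain ⟨u, v, rfl⟩ := List.append_of_mem hc
  rw [List.append_cons, iterWord_append, iterWord_append]
  intro x hx
  simp [hx]

theorem length_iterWord_le {m : ℕ} {c : A} {w : List A} (hc : c ∈ w) :
    (iterWord φ m [c]).length ≤ (iterWord φ m w).length := by
  obtain ⟨u, v, rfl⟩ := List.append_of_mem hc
  rw [List.append_cons, iterWord_append, iterWord_append]
  simp only [List.length_append]
  omega

theorem mem_iterWord_trans {m q : ℕ} {a b c : A} (hb : b ∈ iterWord φ m [a])
    (hc : c ∈ iterWord φ q [b]) : c ∈ iterWord φ (q + m) [a] := by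
  rw [iterWord_add]
  exact iterWord_subset hb hc

theorem mem_iterWord_mul {n : ℕ} {b : A} (hb : b ∈ iterWord φ n [b]) (m : ℕ) :
    b ∈ iterWord φ (m * n) [b] := by
  induction m with
  | zero => simp [iterWord]
  | succ m ih => rw [Nat.succ_mul]; exact mem_iterWord_trans hb ih

theorem length_le_length_substWord (hφ : ∀ b : A, φ b ≠ []) (w : List A) :
    w.length ≤ (substWord φ w).length := by
  induction w with
  | nil => simp
  | cons a w ih =>
    have := List.length_pos_iff.2 (hφ a)
    simp only [substWord, List.length_append, List.length_cons]
    omega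

theorem monotone_length_iterWord (hφ : ∀ b : A, φ b ≠ []) (w : List A) :
    Monotone fun m => (iterWord φ m w).length := by
  refine monotone_nat_of_le_succ fun m => ?_
  simp only [iterWord, Function.iterate_succ_apply']
  exact length_le_length_substWord hφ _

end IterWord

section Growth

theorem isTheta_add_pow {f g : ℕ → ℕ} {a b : ℕ} (hab : b ≤ a)
    (hf : (fun n => (f n : ℝ)) =Θ[atTop] fun n : ℕ => (n : ℝ) ^ a)
    (hg : (fun n => (g n : ℝ)) =Θ[atTop] fun n : ℕ => (n : ℝ) ^ b) :
    (fun n => ((f n + g n : ℕ) : ℝ)) =Θ[atTop] fun n : ℕ => (n : ℝ) ^ a := by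
  have hpow : (fun n : ℕ => (n : ℝ) ^ b) =O[atTop] fun n : ℕ => (n : ℝ) ^ a := by
    refine IsBigO.of_bound 1 ?_
    filter_upwards [eventually_ge_atTop 1] with n hn
    have : (1 : ℝ) ≤ n := by exact_mod_cast hn
    simpa using pow_le_pow_right₀ this hab
  constructor
  · simpa using hf.1.add (hg.1.trans hpow)
  · refine hf.2.trans (IsBigO.of_bound 1 (Eventually.of_forall fun n => ?_))
    simp only [Real.norm_natCast, one_mul]
    exact_mod_cast Nat.le_add_right _ _

theorem not_isBigO_pow_of_lt {a b : ℕ} (hab : a < b) :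
    ¬ (fun n : ℕ => (n : ℝ) ^ b) =O[atTop] fun n : ℕ => (n : ℝ) ^ a := by
  intro h
  have h' : (fun n : ℕ => (n : ℝ) ^ a) =o[atTop] fun n : ℕ => (n : ℝ) ^ b :=
    (isLittleO_pow_pow_atTop_of_lt hab).comp_tendsto tendsto_natCast_atTop_atTop
  refine isLittleO_irrefl ?_ (h.trans_isLittleO h')
  refine (eventually_ge_atTop 1).frequently.mono fun n hn => ?_
  have : (n : ℝ) ≠ 0 := by exact_mod_cast Nat.one_le_iff_ne_zero.1 hn
  exact pow_ne_zero _ this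

theorem eq_of_isTheta_pow {f : ℕ → ℝ} {a b : ℕ}
    (ha : f =Θ[atTop] fun n : ℕ => (n : ℝ) ^ a)
    (hb : f =Θ[atTop] fun n : ℕ => (n : ℝ) ^ b) : a = b := by
  rcases lt_trichotomy a b with h | h | h
  · exact (not_isBigO_pow_of_lt h (hb.2.trans ha.1)).elim
  · exact h
  · exact (not_isBigO_pow_of_lt h (ha.2.trans hb.1)).elim

theorem isBigO_comp_add_pow {f : ℕ → ℝ} {e : ℕ} (q : ℕ)
    (hf : f =O[atTop] fun n : ℕ => (n : ℝ) ^ e) :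
    (fun n => f (n + q)) =O[atTop] fun n : ℕ => (n : ℝ) ^ e := by
  refine (hf.comp_tendsto (tendsto_add_atTop_nat q)).trans (IsBigO.of_bound (2 ^ e) ?_)
  filter_upwards [eventually_ge_atTop q] with n hn
  have : (q : ℝ) ≤ n := by exact_mod_cast hn
  simp only [Function.comp_apply, norm_pow, Real.norm_natCast, ← mul_pow]
  push_cast
  gcongr
  linarith

theorem isBigO_comp_mul_pow {f : ℕ → ℝ} {e n : ℕ} (hn : 1 ≤ n)
    (hf : f =O[atTop] fun m : ℕ => (m : ℝ) ^ e) :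
    (fun m => f (n * m)) =O[atTop] fun m : ℕ => (m : ℝ) ^ e := by
  refine (hf.comp_tendsto (tendsto_id.const_mul_atTop' hn)).trans
    (IsBigO.of_bound ((n : ℝ) ^ e) (Eventually.of_forall fun m => ?_))
  simp [mul_pow]

theorem isBigO_pow_of_comp_succ {f : ℕ → ℝ} {e : ℕ}
    (hf : (fun n : ℕ => (n : ℝ) ^ e) =O[atTop] fun n => f (n + 1)) :
    (fun n : ℕ => (n : ℝ) ^ e) =O[atTop] f := by
  have h1 : (fun n : ℕ => (n : ℝ) ^ e) =O[atTop] fun n : ℕ => ((n - 1 : ℕ) : ℝ) ^ e := by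
    refine IsBigO.pow (IsBigO.of_bound 2 ?_) e
    filter_upwards [eventually_ge_atTop 2] with n hn
    simp only [Real.norm_natCast]
    exact_mod_cast (by omega : n ≤ 2 * (n - 1))
  refine h1.trans ((hf.comp_tendsto (tendsto_sub_atTop_nat 1)).congr' EventuallyEq.rfl ?_)
  filter_upwards [eventually_ge_atTop 1] with n hn
  simp [Nat.sub_add_cancel hn]

/-- A sequence of polynomial growth cannot double along an arithmetic progression. -/
theorem not_isBigO_pow_of_double {f : ℕ → ℕ} {T e : ℕ} (hT : 1 ≤ T) (h0 : 1 ≤ f 0)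
    (hf : ∀ s, 2 * f s ≤ f (s + T)) :
    ¬ (fun n => (f n : ℝ)) =O[atTop] fun n : ℕ => (n : ℝ) ^ e := by
  intro h
  have hpow : ∀ m, 2 ^ m ≤ f (T * m) := by
    intro m
    induction m with
    | zero => simpa using h0
    | succ m ih =>
      have := hf (T * m)
      rw [pow_succ, Nat.mul_succ T]
      omega
  have h1 : (fun m : ℕ => (2 : ℝ) ^ m) =O[atTop] fun m : ℕ => (m : ℝ) ^ e := by
    refine IsBigO.trans (IsBigO.of_bound 1 (Eventually.of_forall fun m => ?_))
      (isBigO_comp_mul_pow hT h)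
    simp only [norm_pow, Real.norm_ofNat, Real.norm_natCast, one_mul]
    exact_mod_cast hpow m
  refine isLittleO_irrefl ?_
    (h1.trans_isLittleO (isLittleO_pow_const_const_pow_of_one_lt e one_lt_two))
  exact Frequently.of_forall fun m => by positivity

/-- Summing a monotone sequence of order `x ^ e` along an arithmetic progression yields a
sequence of order `x ^ (e + 1)`. -/
theorem isTheta_pow_succ_of_recurrence {f h : ℕ → ℕ} {n e : ℕ} (hn : 1 ≤ n)
    (hf : Monotone f) (hh : Monotone h) (hrec : ∀ x, f (x + n) = f x + h x)
    (hθ : (fun x => (h x : ℝ)) =Θ[atTop] fun x : ℕ => (x : ℝ) ^ e) :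
    (fun x => (f x : ℝ)) =Θ[atTop] fun x : ℕ => (x : ℝ) ^ (e + 1) := by
  have upper : ∀ m, f (n * m) ≤ f 0 + m * h (n * m) := by
    intro m
    induction m with
    | zero => simp
    | succ m ih =>
      have hle : h (n * m) ≤ h (n * (m + 1)) := hh (by gcongr; omega)
      have := Nat.mul_le_mul_left (m + 1) hle
      rw [Nat.mul_succ n m, hrec, ← Nat.mul_succ n m]
      simp only [Nat.succ_eq_add_one] at *
      nlinarith
  have lower : ∀ m j, j * h (n * m) ≤ f (n * m + n * j) := by
    intro m j
    induction j with
    | zero => simp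
    | succ j ih =>
      have hle : h (n * m) ≤ h (n * m + n * j) := hh (by omega)
      rw [Nat.mul_succ n j, ← Nat.add_assoc, hrec]
      nlinarith
  constructor
  · have h1 : (fun x => (f x : ℝ)) =O[atTop] fun x => ((f 0 : ℝ) + x * (h (n * x) : ℝ)) := by
      refine IsBigO.of_bound 1 (Eventually.of_forall fun x => ?_)
      have hx : f x ≤ f 0 + x * h (n * x) := (hf (Nat.le_mul_of_pos_left x hn)).trans (upper x)
      rw [Real.norm_natCast, one_mul, Real.norm_of_nonneg (by positivity)]
      exact_mod_cast hx
    refine h1.trans (IsBigO.add ?_ ?_)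
    · refine IsBigO.of_bound (f 0) ?_
      filter_upwards [eventually_ge_atTop 1] with x hx
      have : (1 : ℝ) ≤ x := by exact_mod_cast hx
      simp only [norm_pow, Real.norm_natCast]
      exact le_mul_of_one_le_right (by positivity) (one_le_pow₀ this)
    · simp only [pow_succ']
      exact (isBigO_refl _ _).mul (isBigO_comp_mul_pow hn hθ.1)
  · have hm : Tendsto (fun x : ℕ => x / (2 * n)) atTop atTop :=
      Nat.tendsto_div_const_atTop (by omega)
    have hnm : Tendsto (fun x : ℕ => n * (x / (2 * n))) atTop atTop :=
      hm.const_mul_atTop' hn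
    have h1 : (fun x : ℕ => (x : ℝ)) =O[atTop] fun x : ℕ => ((x / (2 * n) : ℕ) : ℝ) := by
      refine IsBigO.of_bound (4 * n) ?_
      filter_upwards [hm.eventually_ge_atTop 1] with x hx
      have hlt : x < 2 * n * (x / (2 * n) + 1) := Nat.lt_mul_div_succ x (by omega)
      simp only [Real.norm_natCast]
      have : x ≤ 4 * n * (x / (2 * n)) := by nlinarith
      exact_mod_cast this
    have h2 : (fun x : ℕ => (x : ℝ) ^ e) =O[atTop] fun x : ℕ => (h (n * (x / (2 * n))) : ℝ) := by
      refine IsBigO.trans ?_ (hθ.2.comp_tendsto hnm)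
      refine (h1.trans (IsBigO.of_bound 1 (Eventually.of_forall fun x => ?_))).pow e
      simp only [Real.norm_natCast, one_mul]
      exact_mod_cast Nat.le_mul_of_pos_left _ hn
    simp only [pow_succ']
    refine (h1.mul h2).trans (IsBigO.of_bound 1 (Eventually.of_forall fun x => ?_))
    have hx : x / (2 * n) * h (n * (x / (2 * n))) ≤ f x := by
      refine (lower _ _).trans (hf ?_)
      have := Nat.mul_div_le x (2 * n)
      linarith
    rw [Real.norm_natCast, one_mul, Real.norm_of_nonneg (by positivity)]
    exact_mod_cast hx

end Growth

section Order

variable {A : Type*} {φ : A → List A}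

/-- The growth of a nonempty word, all of whose letters have an order, is that of one of its
letters. -/
theorem exists_mem_isTheta_length_iterWord (w : List A) (hw : w ≠ [])
    (h : ∀ c ∈ w, ∃ k, HasOrder φ c k) :
    ∃ c ∈ w, ∃ k, HasOrder φ c k ∧
      (fun n => ((iterWord φ n w).length : ℝ)) =Θ[atTop] fun n : ℕ => (n : ℝ) ^ (k - 1) := by
  induction w with
  | nil => exact (hw rfl).elim
  | cons a w ih =>
    obtain ⟨k, hk⟩ := h a (by simp)
    rcases eq_or_ne w [] with rfl | hne
    · exact ⟨a, by simp, k, hk, hk.2⟩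
    obtain ⟨c, hc, l, hl, hθ⟩ := ih hne fun c hc => h c (List.mem_cons_of_mem _ hc)
    have hlen : ∀ n, (iterWord φ n (a :: w)).length =
        (iterWord φ n [a]).length + (iterWord φ n w).length := fun n => by
      rw [← List.singleton_append, iterWord_append, List.length_append]
    simp only [hlen]
    rcases le_total (l - 1) (k - 1) with hle | hle
    · exact ⟨a, by simp, k, hk, isTheta_add_pow hle hk.2 hθ⟩
    · refine ⟨c, List.mem_cons_of_mem _ hc, l, hl, ?_⟩
      simpa only [Nat.add_comm] using isTheta_add_pow hle hθ hk.2

theorem length_iterWord_recurrence {n : ℕ} {b : A} {u v : List A}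
    (h : iterWord φ n [b] = u ++ b :: v) (x : ℕ) :
    (iterWord φ (x + n) [b]).length =
      (iterWord φ x [b]).length + (iterWord φ x (u ++ v)).length := by
  rw [iterWord_add, h, List.append_cons]
  simp only [iterWord_append, List.length_append]
  omega

/-- A periodic letter whose cofactors in `φ^n(b)` all have an order is of order `1` or of order
one more than that of some letter of `φ^n(b)`. -/
theorem hasOrder_of_periodic (hφ : ∀ b : A, φ b ≠ []) {n : ℕ} (hn : 1 ≤ n) {b : A}
    {u v : List A} (h : iterWord φ n [b] = u ++ b :: v)
    (huv : ∀ c ∈ u ++ v, ∃ k, HasOrder φ c k) :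
    HasOrder φ b 1 ∨ ∃ c ∈ u ++ v, ∃ k, HasOrder φ c k ∧ HasOrder φ b (k + 1) := by
  have hrec := length_iterWord_recurrence h
  have hmono := monotone_length_iterWord hφ [b]
  rcases eq_or_ne (u ++ v) [] with hnil | hne
  · left
    have hmul : ∀ m, (iterWord φ (n * m) [b]).length = 1 := by
      intro m
      induction m with
      | zero => simp [iterWord]
      | succ m ih => rw [Nat.mul_succ, hrec, ih, hnil, iterWord_nil]; rfl
    have hone : ∀ x, (iterWord φ x [b]).length = 1 := fun x =>
      le_antisymm ((hmono (Nat.le_mul_of_pos_left x hn)).trans (hmul x).le)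
        (hmono (Nat.zero_le x))
    refine ⟨le_rfl, ?_⟩
    simp only [hone, Nat.sub_self, pow_zero, Nat.cast_one]
    exact isTheta_refl _ _
  · right
    obtain ⟨c, hc, k, hk, hθ⟩ := exists_mem_isTheta_length_iterWord _ hne huv
    refine ⟨c, hc, k, hk, by omega, ?_⟩
    have := isTheta_pow_succ_of_recurrence hn hmono (monotone_length_iterWord hφ _) hrec hθ
    rwa [Nat.sub_add_cancel hk.1] at this

/-- If `φ^n(b) = u b v` and `b` has polynomial growth, then no letter of `u v` leads back
to `b`. -/
theorem notMem_iterWord_of_isBigO {n e : ℕ} (hn : 1 ≤ n) {b : A} {u v : List A}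
    (h : iterWord φ n [b] = u ++ b :: v)
    (hpoly : (fun m => ((iterWord φ m [b]).length : ℝ)) =O[atTop] fun m : ℕ => (m : ℝ) ^ e)
    {c : A} (hc : c ∈ u ++ v) (q : ℕ) : b ∉ iterWord φ q [c] := by
  intro hq
  have hbb : b ∈ iterWord φ n [b] := by simp [h]
  have hbc : c ∈ iterWord φ n [b] := by
    rw [h]; simp only [List.mem_append, List.mem_cons] at hc ⊢; tauto
  obtain ⟨n, rfl⟩ : ∃ l, n = l + 1 := ⟨n - 1, by omega⟩
  have hcyc : b ∈ iterWord φ (q + (n + 1)) [b] := mem_iterWord_trans hbc hq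
  obtain ⟨r, hr⟩ : ∃ r, r = n * (q + (n + 1)) + q := ⟨_, rfl⟩
  have hcr : b ∈ iterWord φ r [c] := hr ▸ mem_iterWord_trans hq (mem_iterWord_mul hcyc n)
  have hbr : b ∈ iterWord φ r [b] := by
    have := mem_iterWord_mul hbb (n + q)
    rwa [show (n + q) * (n + 1) = r by rw [hr]; ring] at this
  have hsplit : ∃ x y, iterWord φ (r + (n + 1)) [b] = x ++ y ∧ b ∈ x ∧ b ∈ y := by
    rw [iterWord_add, h]
    rcases List.mem_append.1 hc with hcu | hcv
    · exact ⟨_, _, iterWord_append _ _ _, iterWord_subset hcu hcr,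
        iterWord_subset (by simp) hbr⟩
    · rw [List.append_cons]
      exact ⟨_, _, iterWord_append _ _ _, iterWord_subset (by simp) hbr,
        iterWord_subset hcv hcr⟩
  obtain ⟨x, y, hxy, hx, hy⟩ := hsplit
  refine not_isBigO_pow_of_double (f := fun m => (iterWord φ m [b]).length)
    (T := r + (n + 1)) (by omega) (by simp [iterWord]) (fun s => ?_) hpoly
  have h1 := length_iterWord_le (φ := φ) (m := s) hx
  have h2 := length_iterWord_le (φ := φ) (m := s) hy
  rw [iterWord_add s, hxy, iterWord_append, List.length_append]
  omega

theorem isBigO_length_iterWord_of_mem {q e : ℕ} {b c : A} (hc : c ∈ iterWord φ q [b])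
    (hpoly : (fun m => ((iterWord φ m [b]).length : ℝ)) =O[atTop] fun m : ℕ => (m : ℝ) ^ e) :
    (fun m => ((iterWord φ m [c]).length : ℝ)) =O[atTop] fun m : ℕ => (m : ℝ) ^ e := by
  refine IsBigO.trans (IsBigO.of_bound 1 (Eventually.of_forall fun m => ?_))
    (isBigO_comp_add_pow q hpoly)
  simp only [Real.norm_natCast, one_mul, iterWord_add]
  exact_mod_cast length_iterWord_le hc

theorem ncard_descendants_lt [Finite A] {q : ℕ} {b c : A} (hc : c ∈ iterWord φ q [b])
    (hb : ∀ m, b ∉ iterWord φ m [c]) :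
    {x | ∃ m, x ∈ iterWord φ m [c]}.ncard < {x | ∃ m, x ∈ iterWord φ m [b]}.ncard := by
  refine Set.ncard_lt_ncard (Set.ssubset_iff_exists.2 ⟨?_, b, ⟨0, by simp [iterWord]⟩, ?_⟩)
    (Set.toFinite _)
  · rintro x ⟨m, hm⟩
    exact ⟨m + q, mem_iterWord_trans hc hm⟩
  · rintro ⟨m, hm⟩
    exact hb m hm

/-- Every letter of polynomially bounded growth has a finite order. -/
theorem exists_hasOrder_of_isBigO [Finite A] (hφ : ∀ b : A, φ b ≠ []) {e : ℕ} (b : A)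
    (hpoly : (fun m => ((iterWord φ m [b]).length : ℝ)) =O[atTop] fun m : ℕ => (m : ℝ) ^ e) :
    ∃ k, HasOrder φ b k := by
  induction hN : {x | ∃ m, x ∈ iterWord φ m [b]}.ncard using Nat.strong_induction_on
    generalizing b with
  | _ N ih =>
  subst hN
  have step : ∀ q c, c ∈ iterWord φ q [b] → (∀ m, b ∉ iterWord φ m [c]) →
      ∃ k, HasOrder φ c k := fun q c hc hb =>
    ih _ (ncard_descendants_lt hc hb) c (isBigO_length_iterWord_of_mem hc hpoly) rfl
  by_cases hper : ∃ n, 1 ≤ n ∧ b ∈ iterWord φ n [b]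
  · obtain ⟨n, hn, hb⟩ := hper
    obtain ⟨u, v, huv⟩ := List.append_of_mem hb
    have hord : ∀ c ∈ u ++ v, ∃ k, HasOrder φ c k := fun c hc =>
      step n c (by rw [huv]; simp only [List.mem_append, List.mem_cons] at hc ⊢; tauto)
        (notMem_iterWord_of_isBigO hn huv hpoly hc)
    rcases hasOrder_of_periodic hφ hn huv hord with h | ⟨c, -, k, -, h⟩
    exacts [⟨_, h⟩, ⟨_, h⟩]
  · have hord : ∀ c ∈ φ b, ∃ k, HasOrder φ c k := fun c hc => by
      rw [← iterWord_one (φ := φ)] at hc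
      exact step 1 c hc fun m hm => hper ⟨m + 1, by omega, mem_iterWord_trans hc hm⟩
    obtain ⟨c, hc, k, hk, hθ⟩ := exists_mem_isTheta_length_iterWord _ (hφ b) hord
    refine ⟨k, hk.1, ?_, ?_⟩
    · refine IsBigO.trans (IsBigO.of_bound 1 (Eventually.of_forall fun m => ?_)) hθ.1
      simp only [Real.norm_natCast, one_mul, ← iterWord_one (φ := φ), ← iterWord_add]
      exact_mod_cast monotone_length_iterWord hφ [b] (Nat.le_succ m)
    · have hlen : ∀ m, (iterWord φ m (φ b)).length = (iterWord φ (m + 1) [b]).length := fun m => by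
        rw [iterWord_add, iterWord_one]
      simp only [hlen] at hθ
      exact isBigO_pow_of_comp_succ hθ.2

end Order

/-- If `b` is a (periodic) letter of finite order `k > 1` and `b` occurs in
`φ^n(b)` for some `n ≥ 1`, then `φ^n(b)` contains at least one letter of
order `k − 1`. -/
theorem stmt8 {A : Type*} [Fintype A] (φ : A → List A)
    (hφ : ∀ b : A, φ b ≠ []) (b : A) (k : ℕ)
    (hb : HasOrder φ b k) (hk : 1 < k)
    (n : ℕ) (hn : 1 ≤ n) (hmem : b ∈ iterWord φ n [b]) :
    ∃ c ∈ iterWord φ n [b], HasOrder φ c (k - 1) := by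
  obtain ⟨u, v, huv⟩ := List.append_of_mem hmem
  have hsub : ∀ c ∈ u ++ v, c ∈ iterWord φ n [b] := fun c hc => by
    rw [huv]; simp only [List.mem_append, List.mem_cons] at hc ⊢; tauto
  have hord : ∀ c ∈ u ++ v, ∃ l, HasOrder φ c l := fun c hc =>
    exists_hasOrder_of_isBigO hφ c (isBigO_length_iterWord_of_mem (hsub c hc) hb.2.1)
  rcases hasOrder_of_periodic hφ hn huv hord with h | ⟨c, hc, l, hl, h⟩
  · have := eq_of_isTheta_pow hb.2 h.2
    omega
  · have := eq_of_isTheta_pow hb.2 h.2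
    obtain rfl : l = k - 1 := by omega
    exact ⟨c, hsub c hc, hl⟩
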